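/- Let p be a prime, n ≥ 0, and let u, v be integers with 1 ≤ u < p^n, u ≤ v < 2p^n, and v - u even. Let k ∈ {1, -1}, and let c ≥ 1 and d ≥ 0 be integers with c + d ≤ p. If (v-u)/2 ≺_k u, then 2c·p^n - v ≥ u, the number (2c·p^n - v) - u is even, and ((2c·p^n - v) - u)/2 ≺_{-k} (u + d·p^n). -/

import Mathlib

/-- The `i`-th digit of `a` in base `p`. -/
def pDigit (p a i : ℕ) : ℕ := a / p ^ i % p

/-- `a ⊂ b` : each nonzero base-`p` digit of `a` agrees with the corresponding digit of `b`. -/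
def PSub (p a b : ℕ) : Prop := ∀ i, pDigit p a i = 0 ∨ pDigit p a i = pDigit p b i

/-- `a ≺₁ b` : with `s` the `p`-adic valuation of `b`, the digits of `a` vanish up to `s`
and `a_i + b_i < p` above `s`. -/
def PrecOne (p a b : ℕ) : Prop :=
  (∀ i ≤ padicValNat p b, pDigit p a i = 0) ∧
  (∀ i, padicValNat p b < i → pDigit p a i + pDigit p b i < p)

/-- `a ≺₋₁ b` : with `s` the `p`-adic valuation of `b`, the digits of `a` vanish below `s`,
`a_s + b_s = p`, and `a_i + b_i < p` above `s`. -/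
def PrecNegOne (p a b : ℕ) : Prop :=
  (∀ i < padicValNat p b, pDigit p a i = 0) ∧
  pDigit p a (padicValNat p b) + pDigit p b (padicValNat p b) = p ∧
  (∀ i, padicValNat p b < i → pDigit p a i + pDigit p b i < p)

/-- `a ≺ b` : `a ≺₁ b` or `a ≺₋₁ b`. -/
def Prec (p a b : ℕ) : Prop := PrecOne p a b ∨ PrecNegOne p a b

/-- `a ≺_k b` for a sign `k ∈ {1, -1}` : `a ≺₁ b` when `k = 1`, and `a ≺₋₁ b` when `k = -1`. -/
def PrecK (p : ℕ) (k : ℤ) (a b : ℕ) : Prop :=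
  if k = 1 then PrecOne p a b else PrecNegOne p a b

theorem pDigit_zero (p a : ℕ) : pDigit p a 0 = a % p := by
  simp [pDigit]

theorem pDigit_mul_add_succ {p y : ℕ} (hy : y < p) (x i : ℕ) :
    pDigit p (p * x + y) (i + 1) = pDigit p x i := by
  have hp : 0 < p := by omega
  have h : (p * x + y) / p = x := by
    rw [Nat.mul_add_div hp, Nat.div_eq_of_lt hy, add_zero]
  simp only [pDigit]
  rw [pow_succ', ← Nat.div_div_eq_div_mul, h]

theorem pDigit_pow_mul_of_lt {p : ℕ} (hp : 0 < p) {s i : ℕ} (hi : i < s) (x : ℕ) :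
    pDigit p (p ^ s * x) i = 0 := by
  obtain ⟨t, rfl⟩ := Nat.exists_eq_add_of_lt hi
  have h : p ^ (i + t + 1) * x = p ^ i * (p * (p ^ t * x)) := by ring
  simp only [pDigit]
  rw [h, Nat.mul_div_cancel_left _ (pow_pos hp i), Nat.mul_mod_right]

theorem pDigit_pow_mul_add {p : ℕ} (hp : 0 < p) (s i x : ℕ) :
    pDigit p (p ^ s * x) (s + i) = pDigit p x i := by
  simp only [pDigit]
  rw [pow_add, ← Nat.div_div_eq_div_mul, Nat.mul_div_cancel_left _ (pow_pos hp s)]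

theorem pDigit_pow_mul_self {p y : ℕ} (hy : y < p) (s x : ℕ) :
    pDigit p (p ^ s * (p * x + y)) s = y := by
  have h := pDigit_pow_mul_add (by omega : 0 < p) s 0 (p * x + y)
  rw [add_zero] at h
  rw [h, pDigit_zero, Nat.mul_add_mod, Nat.mod_eq_of_lt hy]

theorem pDigit_pow_mul_above {p y : ℕ} (hy : y < p) (s x i : ℕ) :
    pDigit p (p ^ s * (p * x + y)) (s + (i + 1)) = pDigit p x i := by
  rw [pDigit_pow_mul_add (by omega), pDigit_mul_add_succ hy]

theorem pow_dvd_of_pDigit_eq_zero {p a : ℕ} (hp : 0 < p) (s : ℕ)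
    (h : ∀ i < s, pDigit p a i = 0) : p ^ s ∣ a := by
  induction s with
  | zero => simp
  | succ s ih =>
    obtain ⟨x, rfl⟩ := ih fun i hi => h i (by omega)
    have hs := h s (by omega)
    simp only [pDigit, Nat.mul_div_cancel_left _ (pow_pos hp s)] at hs
    rw [pow_succ]
    exact Nat.mul_dvd_mul_left _ (Nat.dvd_of_mod_eq_zero hs)

theorem exists_eq_pow_mul {p a : ℕ} (hp : 0 < p) (s : ℕ) (h : ∀ i < s, pDigit p a i = 0) :
    ∃ x y, y < p ∧ a = p ^ s * (p * x + y) := by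
  obtain ⟨z, rfl⟩ := pow_dvd_of_pDigit_eq_zero hp s h
  exact ⟨z / p, z % p, Nat.mod_lt _ hp, by rw [Nat.div_add_mod]⟩

theorem padicValNat_pow_mul {p y : ℕ} (hp : p.Prime) (hy0 : 0 < y) (hy : y < p) (s x : ℕ) :
    padicValNat p (p ^ s * (p * x + y)) = s := by
  have := Fact.mk hp
  have hnd : ¬ p ∣ p * x + y := by
    rw [Nat.dvd_add_right (dvd_mul_right p x)]
    exact Nat.not_dvd_of_pos_of_lt hy0 hy
  rw [padicValNat.mul (pow_ne_zero _ hp.ne_zero) (by omega), padicValNat.prime_pow,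
    padicValNat.eq_zero_of_not_dvd hnd, add_zero]

/-- If `a` and `u` are below `p ^ m` and add without carries, so do `c p ^ m - 1 - a - u` and
`u + d p ^ m`. -/
theorem pDigit_add_lt_of_add_eq {p c d : ℕ} (hp : 1 < p) (hc : 1 ≤ c) (hcd : c + d ≤ p) (m : ℕ) :
    ∀ a u b : ℕ, (∀ i, pDigit p a i + pDigit p u i < p) → a < p ^ m → u < p ^ m →
      a + u + b + 1 = c * p ^ m → ∀ i, pDigit p b i + pDigit p (u + d * p ^ m) i < p := by
  induction m with
  | zero =>
    intro a u b _ ha hu h i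
    simp only [pow_zero, mul_one] at *
    obtain rfl : a = 0 := by omega
    obtain rfl : u = 0 := by omega
    rw [zero_add]
    rcases i with _ | i
    · rw [pDigit_zero, pDigit_zero, Nat.mod_eq_of_lt (by omega), Nat.mod_eq_of_lt (by omega)]
      omega
    · have key : ∀ y < p, pDigit p y (i + 1) = 0 := fun y hy => by
        simpa [pDigit] using pDigit_mul_add_succ hy 0 i
      rw [key b (by omega), key d (by omega)]
      omega
  | succ m ih =>
    intro a u b hau ha hu h
    have hp0 : 0 < p := by omega
    have split : ∀ z : ℕ, ∃ x y, y < p ∧ z = p * x + y := fun z =>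
      ⟨z / p, z % p, Nat.mod_lt _ hp0, (Nat.div_add_mod z p).symm⟩
    obtain ⟨a', a₀, ha₀, rfl⟩ := split a
    obtain ⟨u', u₀, hu₀, rfl⟩ := split u
    obtain ⟨b', b₀, hb₀, rfl⟩ := split b
    have h0 := hau 0
    simp only [pDigit_zero, Nat.mul_add_mod, Nat.mod_eq_of_lt ha₀, Nat.mod_eq_of_lt hu₀] at h0
    rw [pow_succ'] at ha hu h
    have hsum : a₀ + u₀ + b₀ + 1 = p := by
      have hdvd : p ∣ a₀ + u₀ + b₀ + 1 := by
        rw [← Nat.dvd_add_right (dvd_mul_right p (a' + u' + b'))]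
        exact ⟨c * p ^ m, by linarith⟩
      obtain ⟨q, hq⟩ := hdvd
      have : q = 1 := by
        have h1 : p * q < p * 2 := by omega
        have h2 : q < 2 := Nat.lt_of_mul_lt_mul_left h1
        have h3 : q ≠ 0 := by rintro rfl; omega
        omega
      rw [hq, this, mul_one]
    have hrec : a' + u' + b' + 1 = c * p ^ m := by
      apply Nat.eq_of_mul_eq_mul_left hp0
      linarith
    have key := ih a' u' b'
      (fun i => by
        have := hau (i + 1)
        rwa [pDigit_mul_add_succ ha₀, pDigit_mul_add_succ hu₀] at this)
      (Nat.lt_of_mul_lt_mul_left (a := p) (by omega))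
      (Nat.lt_of_mul_lt_mul_left (a := p) (by omega)) hrec
    have hud : p * u' + u₀ + d * p ^ (m + 1) = p * (u' + d * p ^ m) + u₀ := by ring
    rw [hud]
    rintro (_ | i)
    · simp only [pDigit_zero, Nat.mul_add_mod, Nat.mod_eq_of_lt hb₀, Nat.mod_eq_of_lt hu₀]
      omega
    · rw [pDigit_mul_add_succ hb₀, pDigit_mul_add_succ hu₀]
      exact key i

theorem add_lt_pow_of_pDigit_add_lt {p : ℕ} (m : ℕ) :
    ∀ a u : ℕ, (∀ i, pDigit p a i + pDigit p u i < p) → a < p ^ m → u < p ^ m →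
      a + u < p ^ m := by
  induction m with
  | zero => intro a u _ ha hu; simp only [pow_zero] at *; omega
  | succ m ih =>
    intro a u hau ha hu
    have h0 := hau 0
    simp only [pDigit_zero] at h0
    rw [pow_succ] at ha hu
    have key := ih (a / p) (u / p)
      (fun i => by
        have := hau (i + 1)
        simpa only [pDigit, pow_succ', Nat.div_div_eq_div_mul] using this)
      (Nat.div_lt_of_lt_mul (by linarith)) (Nat.div_lt_of_lt_mul (by linarith))
    have ha' := Nat.div_add_mod a p
    have hu' := Nat.div_add_mod u p
    have := Nat.mul_le_mul_left p (Nat.succ_le_of_lt key)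
    rw [pow_succ']
    rw [Nat.succ_eq_add_one, mul_add, mul_add] at this
    omega

/-- Let `p` be prime, `n ≥ 0`, and `1 ≤ u < p^n`, `u ≤ v < 2p^n` with `v - u` even.  Let
`k ∈ {1, -1}` and let `c ≥ 1`, `d ≥ 0` with `c + d ≤ p`.  If `(v-u)/2 ≺_k u`, then
`2c·p^n - v ≥ u`, the number `(2c·p^n - v) - u` is even, and
`((2c·p^n - v) - u)/2 ≺_{-k} (u + d·p^n)`. -/
theorem prec_neg_of_prec (p n u v c d : ℕ) (k : ℤ) (hp : p.Prime) (hk : k = 1 ∨ k = -1)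
    (hu : 1 ≤ u) (hun : u < p ^ n) (huv : u ≤ v) (hv : v < 2 * p ^ n)
    (he : 2 ∣ v - u) (hc : 1 ≤ c) (hcd : c + d ≤ p)
    (hprec : PrecK p k ((v - u) / 2) u) :
    u ≤ 2 * c * p ^ n - v ∧ 2 ∣ (2 * c * p ^ n - v - u) ∧
      PrecK p (-k) ((2 * c * p ^ n - v - u) / 2) (u + d * p ^ n) := by
  have hp0 := hp.pos
  have hp1 := hp.one_lt
  obtain ⟨a, ha⟩ := he
  obtain rfl : v = u + 2 * a := by omega
  rw [show (u + 2 * a - u) / 2 = a by omega] at hprec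
  have hapn : a < p ^ n := by omega
  obtain ⟨s, hs⟩ : ∃ s, padicValNat p u = s := ⟨_, rfl⟩
  obtain ⟨x, y, hy0, hy, rfl⟩ : ∃ x y, 0 < y ∧ y < p ∧ u = p ^ s * (p * x + y) := by
    obtain ⟨z, hz⟩ : p ^ s ∣ u := hs ▸ pow_padicValNat_dvd
    have hnd : ¬ p ∣ z := by
      have := Fact.mk hp
      rintro ⟨w, rfl⟩
      apply pow_succ_padicValNat_not_dvd (p := p) (n := u) (by omega)
      exact ⟨w, by rw [hs, hz]; ring⟩
    refine ⟨z / p, z % p, ?_, Nat.mod_lt _ hp0, by rw [Nat.div_add_mod, hz]⟩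
    exact Nat.pos_of_ne_zero fun h => hnd (Nat.dvd_of_mod_eq_zero h)
  have hlow : ∀ i < s, pDigit p a i = 0 := by
    intro i hi
    unfold PrecK at hprec
    split_ifs at hprec
    · exact hprec.1 i (by omega)
    · exact hprec.1 i (by omega)
  obtain ⟨x', y', hy', rfl⟩ := exists_eq_pow_mul hp0 s hlow
  have hcarry : ∀ i, pDigit p x' i + pDigit p x i < p := by
    intro i
    have : pDigit p (p ^ s * (p * x' + y')) (s + (i + 1)) +
        pDigit p (p ^ s * (p * x + y)) (s + (i + 1)) < p := by
      unfold PrecK at hprec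
      split_ifs at hprec
      · exact hprec.2 _ (by omega)
      · exact hprec.2.2 _ (by omega)
    rwa [pDigit_pow_mul_above hy', pDigit_pow_mul_above hy] at this
  have hsn : s < n := by
    rw [← Nat.pow_lt_pow_iff_right hp1]
    exact lt_of_le_of_lt (Nat.le_mul_of_pos_right _ (by omega)) hun
  obtain ⟨m, rfl⟩ := Nat.exists_eq_add_of_lt hsn
  have hpow : p ^ (s + m + 1) = p ^ s * (p * p ^ m) := by ring
  have bound : ∀ z w : ℕ, p ^ s * (p * z + w) < p ^ (s + m + 1) → z < p ^ m := by
    intro z w h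
    rw [hpow] at h
    have := Nat.lt_of_mul_lt_mul_left h
    exact Nat.lt_of_mul_lt_mul_left (a := p) (by omega)
  have hx := bound _ _ hun
  have hx' := bound _ _ hapn
  have hsum := add_lt_pow_of_pDigit_add_lt m x' x hcarry hx' hx
  obtain ⟨b, hb⟩ : ∃ b, x' + x + b + 1 = c * p ^ m :=
    ⟨c * p ^ m - (x' + x + 1), by
      have := Nat.mul_le_mul_right (p ^ m) hc
      omega⟩
  have hcarry' := pDigit_add_lt_of_add_eq hp1 hc hcd m x' x b hcarry hx' hx hb
  have hu' : p ^ s * (p * x + y) + d * p ^ (s + m + 1) = p ^ s * (p * (x + d * p ^ m) + y) := by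
    ring
  have htotal : 2 * c * p ^ (s + m + 1) = 2 * (p ^ s * (p * (x' + x + b + 1))) := by
    rw [hb]; ring
  have reduce : ∀ r, y + y' + r = p →
      p ^ s * (p * x + y) ≤ 2 * c * p ^ (s + m + 1) -
          (p ^ s * (p * x + y) + 2 * (p ^ s * (p * x' + y'))) ∧
        2 * c * p ^ (s + m + 1) - (p ^ s * (p * x + y) + 2 * (p ^ s * (p * x' + y'))) -
          p ^ s * (p * x + y) = 2 * (p ^ s * (p * b + r)) := by
    intro r hr
    have : p ^ s * (p * (x' + x + b + 1)) =
        p ^ s * (p * x + y) + p ^ s * (p * x' + y') + p ^ s * (p * b + r) := by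
      rw [← mul_add, ← mul_add]
      congr 1
      linarith
    omega
  have hval' : padicValNat p (p ^ s * (p * (x + d * p ^ m) + y)) = s :=
    padicValNat_pow_mul hp hy0 hy s _
  have above : ∀ r < p, ∀ i, s < i → pDigit p (p ^ s * (p * b + r)) i +
      pDigit p (p ^ s * (p * (x + d * p ^ m) + y)) i < p := by
    intro r hr i hi
    obtain ⟨j, rfl⟩ := Nat.exists_eq_add_of_lt hi
    rw [add_assoc, pDigit_pow_mul_above hr, pDigit_pow_mul_above hy]
    exact hcarry' j
  rw [hu']
  rcases hk with rfl | rfl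
  · simp only [PrecK, if_true] at hprec
    have hy'0 := hprec.1 s hs.ge
    rw [pDigit_pow_mul_self hy'] at hy'0
    obtain ⟨hle, heq⟩ := reduce (p - y) (by omega)
    refine ⟨hle, ⟨_, heq⟩, ?_⟩
    rw [heq, Nat.mul_div_cancel_left _ two_pos]
    simp only [PrecK, if_neg (show ¬ (-1 : ℤ) = 1 by decide), PrecNegOne, hval']
    refine ⟨fun i hi => pDigit_pow_mul_of_lt hp0 hi _, ?_, above _ (by omega)⟩
    rw [pDigit_pow_mul_self (by omega), pDigit_pow_mul_self hy]
    omega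
  · simp only [PrecK, if_neg (show ¬ (-1 : ℤ) = 1 by decide)] at hprec
    have hyy := hprec.2.1
    rw [hs, pDigit_pow_mul_self hy', pDigit_pow_mul_self hy] at hyy
    obtain ⟨hle, heq⟩ := reduce 0 (by omega)
    refine ⟨hle, ⟨_, heq⟩, ?_⟩
    rw [heq, Nat.mul_div_cancel_left _ two_pos]
    simp only [PrecK, neg_neg, if_true, PrecOne, hval']
    refine ⟨fun i hi => ?_, above 0 hp0⟩
    rcases hi.lt_or_eq with hi | rfl
    · exact pDigit_pow_mul_of_lt hp0 hi _
    · exact pDigit_pow_mul_self hp0 _ _
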